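/- Let m ≥ 1, let u : Fin m → ℝ be strictly monotone, and let P be an m × m partial permutation matrix encoding a voice leading, in the sense that P r s = 1 exactly when some voice moves from pitch u r to pitch u s (distinct voices occupying distinct rows and distinct columns). Fix indices i, j with P i j = 1. Then the number of voices that cross the voice encoded by (i, j) equals the number of entries equal to 1 in positions (r, s) of P with r > i and s < j, plus the number of entries equal to 1 in positions (t, w) with t < i and w > j. -/

import Mathlib

/-- A partial permutation matrix: every row and every column contains at most
one nonzero entry, and every nonzero entry equals `1`. -/
def IsPartialPermMatrix {ι : Type*} (P : Matrix ι ι ℝ) : Prop :=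
  (∀ i j, P i j ≠ 0 → P i j = 1) ∧
  (∀ i j j', P i j ≠ 0 → P i j' ≠ 0 → j = j') ∧
  (∀ i i' j, P i j ≠ 0 → P i' j ≠ 0 → i = i')

/-- Let `u : Fin m → ℝ` be strictly monotone and let `P` be the
partial permutation matrix of a voice leading of `n` voices, with voice `v`
moving from pitch `u (src v)` to pitch `u (tgt v)` (distinct voices occupying
distinct rows and distinct columns), so that `P r s = 1` exactly when some
voice moves from `u r` to `u s`.  If `P i j = 1` then the number of voices
crossing the voice encoded by `(i, j)` equals the number of `1` entries of `P`
in positions `(r, s)` with `r > i` and `s < j` plus the number of `1` entries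
in positions `(t, w)` with `t < i` and `w > j`. -/
theorem card_crossings_eq_card_ones_in_submatrices
    (m n : ℕ) (hm : 1 ≤ m) (u : Fin m → ℝ) (hu : StrictMono u)
    (src tgt : Fin n → Fin m)
    (hsrc : Function.Injective src) (htgt : Function.Injective tgt)
    (P : Matrix (Fin m) (Fin m) ℝ) (hPpp : IsPartialPermMatrix P)
    (hP : ∀ r s, P r s = 1 ↔ ∃ v, src v = r ∧ tgt v = s)
    (i j : Fin m) (hij : P i j = 1) :
    (Finset.univ.filter (fun v : Fin n =>
        (u (src v) < u i ∧ u j < u (tgt v)) ∨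
        (u i < u (src v) ∧ u (tgt v) < u j))).card =
      (Finset.univ.filter (fun p : Fin m × Fin m =>
        P p.1 p.2 = 1 ∧ i < p.1 ∧ p.2 < j)).card +
      (Finset.univ.filter (fun p : Fin m × Fin m =>
        P p.1 p.2 = 1 ∧ p.1 < i ∧ j < p.2)).card := by
  rw [← Finset.card_union_of_disjoint
    (Finset.disjoint_filter.2 fun p _ h h' => lt_asymm h.2.1 h'.2.1)]
  refine Finset.card_nbij (fun v => (src v, tgt v)) ?_ ?_ ?_
  · intro v hv
    simp only [Finset.coe_filter, Finset.mem_univ, true_and, Set.mem_ofPred_eq,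
      hu.lt_iff_lt] at hv
    have hone : P (src v) (tgt v) = 1 := (hP _ _).2 ⟨v, rfl, rfl⟩
    simpa [hone] using hv.symm
  · exact fun v _ w _ h => hsrc (Prod.ext_iff.1 h).1
  · rintro ⟨r, s⟩ hp
    simp only [Finset.coe_union, Finset.coe_filter, Finset.mem_univ, true_and,
      Set.mem_union, Set.mem_ofPred_eq, ← and_or_left] at hp
    obtain ⟨v, rfl, rfl⟩ := (hP r s).1 hp.1
    exact ⟨v, by simpa [hu.lt_iff_lt] using hp.2.symm, rfl⟩
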